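/- Let d ≥ 1, q ∈ (1, ∞), β ∈ (0, (d+2)/q], α ∈ (0, β), and let r satisfy r(β − α) = qβ. Then there exists a constant N = N(d, q, α, β) such that for every measurable f ≥ 0 on ℝ^{d+1} one has ‖P_α f‖_{E_{r, β−α}} ≤ N ‖f‖_{E_{q, β}}. -/

import Mathlib

open MeasureTheory Set ENNReal Filter

noncomputable section

/-- Euclidean space `ℝ^d`. -/
abbrev Ed (d : ℕ) := EuclideanSpace ℝ (Fin d)

/-- Points of `ℝ^{d+1}`: `z = (t, x)`. -/
abbrev Pt (d : ℕ) := ℝ × Ed d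

/-- The parabolic cylinder `C_ρ(t,x)`. -/
def pCyl (d : ℕ) (ρ : ℝ) (z : Pt d) : Set (Pt d) :=
  {w | dist z.2 w.2 < ρ ∧ z.1 ≤ w.1 ∧ w.1 < z.1 + ρ ^ 2}

/-- The average `⨍_{C_ρ(z)} f`. -/
def pAvg (d : ℕ) (ρ : ℝ) (z : Pt d) (f : Pt d → ℝ≥0∞) : ℝ≥0∞ :=
  (volume (pCyl d ρ z))⁻¹ * ∫⁻ w in pCyl d ρ z, f w

/-- The fractional maximal function `M_β f`. -/
def Mbeta (d : ℕ) (β : ℝ) (f : Pt d → ℝ≥0∞) (z : Pt d) : ℝ≥0∞ :=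
  ⨆ (ρ : ℝ) (_ : 0 < ρ), ENNReal.ofReal (ρ ^ β) * pAvg d ρ z f

/-- The kernel `p_α(s, r)`. -/
def pKer (d : ℕ) (α : ℝ) (s r : ℝ) : ℝ≥0∞ :=
  if 0 < s then ENNReal.ofReal (s ^ (-(((d : ℝ) + 2 - α) / 2)) * Real.exp (-(r ^ 2) / s)) else 0

/-- The parabolic potential `P_α f`. -/
def Palpha (d : ℕ) (α : ℝ) (f : Pt d → ℝ≥0∞) (z : Pt d) : ℝ≥0∞ :=
  ∫⁻ w : Pt d, pKer d α w.1 ‖w.2‖ * f (z.1 + w.1, z.2 + w.2)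

/-- The parabolic Morrey norm `‖f‖_{E_{p,β}(Q)}`. -/
def MorreyNorm (d : ℕ) (p β : ℝ) (Q : Set (Pt d)) (f : Pt d → ℝ≥0∞) : ℝ≥0∞ :=
  ⨆ (ρ : ℝ) (_ : 0 < ρ) (z : Pt d) (_ : z ∈ Q),
    ENNReal.ofReal (ρ ^ β) * (pAvg d ρ z fun w => Q.indicator f w ^ p) ^ (1 / p)

/-- The `L_p`-norm on `ℝ^{d+1}`. -/
def LpNormE (d : ℕ) (p : ℝ) (f : Pt d → ℝ≥0∞) : ℝ≥0∞ :=
  (∫⁻ z : Pt d, f z ^ p) ^ (1 / p)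

/-- The mixed norm `‖f‖_{L_{q₁,q₂}}`. -/
def MixedNorm (d : ℕ) (q₁ q₂ : ℝ) (f : Pt d → ℝ≥0∞) : ℝ≥0∞ :=
  (∫⁻ t : ℝ, (∫⁻ x : Ed d, f (t, x) ^ q₁) ^ (q₂ / q₁)) ^ (1 / q₂)

/-- The normalized mixed norm `‖f‖_{L_{q₁,q₂}(Γ)}`. -/
def MixedNormOn (d : ℕ) (q₁ q₂ : ℝ) (Γ : Set (Pt d)) (f : Pt d → ℝ≥0∞) : ℝ≥0∞ :=
  (MixedNorm d q₁ q₂ (Γ.indicator 1))⁻¹ * MixedNorm d q₁ q₂ (Γ.indicator f)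

/-- The mixed-norm parabolic Morrey norm `‖f‖_{E_{q₁,q₂,β}(Q)}`. -/
def MixedMorrey (d : ℕ) (q₁ q₂ β : ℝ) (Q : Set (Pt d)) (f : Pt d → ℝ≥0∞) : ℝ≥0∞ :=
  ⨆ (ρ : ℝ) (_ : 0 < ρ) (z : Pt d) (_ : z ∈ Q),
    ENNReal.ofReal (ρ ^ β) * MixedNormOn d q₁ q₂ (pCyl d ρ z) (Q.indicator f)

/-- The symmetric parabolic maximal function `M̂ f`. -/
def pMax (d : ℕ) (f : Pt d → ℝ≥0∞) (z : Pt d) : ℝ≥0∞ :=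
  ⨆ (r : ℝ) (_ : 0 < r) (w : Pt d) (_ : z ∈ pCyl d r w), pAvg d r w f

/-- The time derivative `∂_t u`. -/
def timeDeriv (d : ℕ) (u : Pt d → ℝ) (z : Pt d) : ℝ :=
  fderiv ℝ u z ((1 : ℝ), (0 : Ed d))

/-- The spatial partial derivative `D_i u`. -/
def spDeriv (d : ℕ) (i : Fin d) (u : Pt d → ℝ) (z : Pt d) : ℝ :=
  fderiv ℝ u z ((0 : ℝ), EuclideanSpace.single i (1 : ℝ))

/-- The Euclidean norm of the spatial gradient `|Du|`. -/
def gradNorm (d : ℕ) (u : Pt d → ℝ) (z : Pt d) : ℝ :=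
  Real.sqrt (∑ i : Fin d, spDeriv d i u z ^ 2)

/-- The spatial Laplacian `Δu`. -/
def lap (d : ℕ) (u : Pt d → ℝ) (z : Pt d) : ℝ :=
  ∑ i : Fin d, spDeriv d i (spDeriv d i u) z

/-- The (Frobenius) norm of the spatial Hessian `|D²u|`. -/
def hessNorm (d : ℕ) (u : Pt d → ℝ) (z : Pt d) : ℝ :=
  Real.sqrt (∑ i : Fin d, ∑ j : Fin d, spDeriv d i (spDeriv d j u) z ^ 2)


theorem meas_pCyl (d : ℕ) (ρ : ℝ) (z : Pt d) : MeasurableSet (pCyl d ρ z) := by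
  have : pCyl d ρ z = Ico z.1 (z.1 + ρ ^ 2) ×ˢ Metric.ball z.2 ρ := by
    ext w
    simp only [pCyl, mem_ofPred_eq, mem_prod, mem_Ico, Metric.mem_ball, dist_comm w.2]
    tauto
  rw [this]
  exact measurableSet_Ico.prod measurableSet_ball

theorem vol_pCyl (d : ℕ) (ρ : ℝ) (hρ : 0 < ρ) (z : Pt d) :
    volume (pCyl d ρ z) = ENNReal.ofReal (ρ ^ ((d : ℝ) + 2)) * volume (Metric.ball (0 : Ed d) 1) := by
  have : pCyl d ρ z = Ico z.1 (z.1 + ρ ^ 2) ×ˢ Metric.ball z.2 ρ := by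
    ext w
    simp only [pCyl, mem_ofPred_eq, mem_prod, mem_Ico, Metric.mem_ball, dist_comm w.2]
    tauto
  rw [this, Measure.volume_eq_prod, Measure.prod_prod, Real.volume_Ico,
    Measure.addHaar_ball_of_pos _ _ hρ, ← mul_assoc, add_sub_cancel_left, ← ENNReal.ofReal_mul (by positivity)]
  congr 2
  rw [finrank_euclideanSpace_fin, Real.rpow_add hρ, Real.rpow_natCast]
  norm_num
  ring

theorem ker_bound (d : ℕ) (α : ℝ) (hα : α < (d : ℝ) + 2) :
    ∃ C : ℝ, 0 < C ∧ ∀ R : ℝ, 0 < R → ∀ w : Pt d, w ∉ pCyl d R 0 →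
      pKer d α w.1 ‖w.2‖ ≤ ENNReal.ofReal (C * R ^ (-((d : ℝ) + 2 - α))) := by
  set k : ℝ := ((d : ℝ) + 2 - α) / 2 with hk
  have hk0 : 0 < k := by rw [hk]; linarith
  refine ⟨1 + k ^ k, by positivity, fun R hR w hw => ?_⟩
  unfold pKer
  split_ifs with hs
  swap
  · exact zero_le
  apply ENNReal.ofReal_le_ofReal
  rw [← hk]
  have e1 : R ^ (-((d : ℝ) + 2 - α)) = (R ^ 2) ^ (-k) := by
    rw [← Real.rpow_natCast, ← Real.rpow_mul hR.le]
    congr 1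
    rw [hk]; push_cast; ring
  rw [e1]
  have hkk : 0 < k ^ k := by positivity
  have hRk : 0 < (R ^ 2) ^ (-k) := by positivity
  by_cases h : R ^ 2 ≤ w.1
  · have h1 : w.1 ^ (-k) ≤ (R ^ 2) ^ (-k) :=
      Real.rpow_le_rpow_of_nonpos (by positivity) h (by linarith)
    have h2 : Real.exp (-(‖w.2‖ ^ 2) / w.1) ≤ 1 := by
      rw [Real.exp_le_one_iff]
      apply div_nonpos_of_nonpos_of_nonneg _ hs.le
      have := sq_nonneg ‖w.2‖
      linarith
    have h3 : 0 < w.1 ^ (-k) := by positivity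
    nlinarith [Real.exp_pos (-(‖w.2‖ ^ 2) / w.1)]
  · have hy : R ≤ ‖w.2‖ := by
      by_contra hc
      apply hw
      simp only [pCyl, mem_ofPred_eq]
      refine ⟨?_, ?_, ?_⟩
      · simpa [dist_eq_norm] using hc
      · simpa using hs.le
      · simpa using h
    set u := R ^ 2 / w.1 with hu
    have hu0 : 0 < u := by positivity
    have h2 : Real.exp (-(‖w.2‖ ^ 2) / w.1) ≤ Real.exp (-u) := by
      apply Real.exp_le_exp.2
      rw [hu, ← neg_div]
      gcongr
    have h1 : w.1 ^ (-k) = (R ^ 2) ^ (-k) * u ^ k := by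
      rw [hu, Real.div_rpow (by positivity) hs.le, Real.rpow_neg hs.le,
        Real.rpow_neg (by positivity)]
      have : 0 < (R ^ 2) ^ k := by positivity
      field_simp
    have h4 : u ^ k ≤ k ^ k * Real.exp u := by
      have h5 : u / k ≤ Real.exp (u / k) := by linarith [Real.add_one_le_exp (u / k)]
      have h6 := Real.rpow_le_rpow (by positivity) h5 hk0.le
      rw [Real.div_rpow hu0.le hk0.le, ← Real.exp_mul, div_mul_cancel₀ _ hk0.ne',
        div_le_iff₀ hkk] at h6
      linarith
    have h7 : u ^ k * Real.exp (-u) ≤ k ^ k := by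
      calc u ^ k * Real.exp (-u) ≤ k ^ k * Real.exp u * Real.exp (-u) := by gcongr
        _ = k ^ k := by rw [mul_assoc, ← Real.exp_add]; simp
    calc w.1 ^ (-k) * Real.exp (-(‖w.2‖ ^ 2) / w.1)
        ≤ (R ^ 2) ^ (-k) * u ^ k * Real.exp (-u) := by rw [h1]; gcongr
      _ = (R ^ 2) ^ (-k) * (u ^ k * Real.exp (-u)) := by ring
      _ ≤ (R ^ 2) ^ (-k) * (k ^ k) := by gcongr
      _ ≤ _ := by nlinarith

theorem meas_ker (d : ℕ) (α : ℝ) : Measurable (fun w : Pt d => pKer d α w.1 ‖w.2‖) := by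
  unfold pKer
  refine Measurable.ite (measurableSet_lt measurable_const measurable_fst) ?_ measurable_const
  fun_prop

theorem vol_inv (d : ℕ) : (volume : Measure (Pt d)).IsAddLeftInvariant := by
  rw [Measure.volume_eq_prod]
  infer_instance

theorem lint_shift (d : ℕ) (R : ℝ) (z : Pt d) (f : Pt d → ℝ≥0∞) :
    ∫⁻ w in pCyl d R 0, f (z + w) = ∫⁻ w in pCyl d R z, f w := by
  have := vol_inv d
  rw [← lintegral_indicator (meas_pCyl _ _ _), ← lintegral_indicator (meas_pCyl _ _ _),
    ← lintegral_add_left_eq_self ((pCyl d R z).indicator _) z]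
  congr 1
  ext w
  have : w ∈ pCyl d R 0 ↔ z + w ∈ pCyl d R z := by
    simp [pCyl, dist_eq_norm]
  by_cases h : w ∈ pCyl d R 0
  · rw [indicator_of_mem h, indicator_of_mem (this.1 h)]
  · rw [indicator_of_notMem h, indicator_of_notMem (fun h' => h (this.2 h'))]

/-- The bound on a single shell. -/
theorem shell (d : ℕ) (α : ℝ) (hα : α < (d : ℝ) + 2) (β : ℝ) :
    ∃ C : ℝ, 0 < C ∧ ∀ (f : Pt d → ℝ≥0∞) (A : ℝ) (z : Pt d), Measurable f → 0 < A →
      (∀ ρ : ℝ, 0 < ρ → ∫⁻ w in pCyl d ρ z, f w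
        ≤ ENNReal.ofReal (A * ρ ^ (-β)) * volume (pCyl d ρ z)) →
      ∀ R : ℝ, 0 < R → ∫⁻ w in pCyl d (2 * R) 0 \ pCyl d R 0, pKer d α w.1 ‖w.2‖ * f (z + w)
        ≤ ENNReal.ofReal (C * A * R ^ (α - β)) := by
  obtain ⟨C, hC, hker⟩ := ker_bound d α hα
  set V : ℝ := (volume (Metric.ball (0 : Ed d) 1)).toReal with hV
  have hVt : volume (Metric.ball (0 : Ed d) 1) ≠ ⊤ := measure_ball_lt_top.ne
  have hV0 : 0 < V := ENNReal.toReal_pos (Metric.measure_ball_pos _ _ one_pos).ne' hVt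
  have hVe : volume (Metric.ball (0 : Ed d) 1) = ENNReal.ofReal V := (ENNReal.ofReal_toReal hVt).symm
  refine ⟨C * 2 ^ ((d : ℝ) + 2 - β) * V, by positivity, fun f A z hf hA hfA R hR => ?_⟩
  have hR2 : 0 < 2 * R := by positivity
  calc ∫⁻ w in pCyl d (2 * R) 0 \ pCyl d R 0, pKer d α w.1 ‖w.2‖ * f (z + w)
      ≤ ∫⁻ w in pCyl d (2 * R) 0 \ pCyl d R 0,
          ENNReal.ofReal (C * R ^ (-((d : ℝ) + 2 - α))) * f (z + w) := by
        apply setLIntegral_mono' ((meas_pCyl _ _ _).diff (meas_pCyl _ _ _))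
        intro w hw
        gcongr
        exact hker R hR w hw.2
    _ ≤ ∫⁻ w in pCyl d (2 * R) 0,
          ENNReal.ofReal (C * R ^ (-((d : ℝ) + 2 - α))) * f (z + w) :=
        lintegral_mono_set sdiff_subset
    _ = ENNReal.ofReal (C * R ^ (-((d : ℝ) + 2 - α))) * ∫⁻ w in pCyl d (2 * R) z, f w := by
        rw [lintegral_const_mul' _ _ ENNReal.ofReal_ne_top, lint_shift]
    _ ≤ ENNReal.ofReal (C * R ^ (-((d : ℝ) + 2 - α))) *
          (ENNReal.ofReal (A * (2 * R) ^ (-β)) * volume (pCyl d (2 * R) z)) := by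
        gcongr
        exact hfA _ hR2
    _ = _ := by
        rw [vol_pCyl _ _ hR2, hVe, ← ENNReal.ofReal_mul (by positivity),
          ← ENNReal.ofReal_mul (by positivity), ← ENNReal.ofReal_mul (by positivity)]
        congr 1
        have e1 : (2 * R) ^ (-β) * (2 * R) ^ ((d : ℝ) + 2)
            = 2 ^ ((d : ℝ) + 2 - β) * R ^ ((d : ℝ) + 2 - β) := by
          rw [← Real.rpow_add hR2, ← Real.mul_rpow (by norm_num) hR.le]
          congr 1; ring
        have e2 : R ^ (-((d : ℝ) + 2 - α)) * R ^ ((d : ℝ) + 2 - β) = R ^ (α - β) := by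
          rw [← Real.rpow_add hR]
          congr 1; ring
        rw [← e2]
        linear_combination C * R ^ (-((d : ℝ) + 2 - α)) * A * V * e1

theorem geom_E (c x : ℝ) (hc : 0 ≤ c) (hx : 0 ≤ x) (hx1 : x < 1) :
    ∑' n : ℕ, ENNReal.ofReal (c * x ^ n) = ENNReal.ofReal (c * (1 - x)⁻¹) := by
  rw [← ENNReal.ofReal_tsum_of_nonneg (fun n => by positivity)
    ((summable_geometric_of_lt_one hx hx1).mul_left c), tsum_mul_left,
    tsum_geometric_of_lt_one hx hx1]

theorem inner_bd (d : ℕ) (α : ℝ) (hα0 : 0 < α) (hα : α < (d : ℝ) + 2) :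
    ∃ C : ℝ, 0 < C ∧ ∀ δ : ℝ, 0 < δ →
      ∫⁻ w in pCyl d δ 0, pKer d α w.1 ‖w.2‖ ≤ ENNReal.ofReal (C * δ ^ α) := by
  obtain ⟨C, hC, hsh⟩ := shell d α hα 0
  have hx1 : (1 / 2 : ℝ) ^ α < 1 := Real.rpow_lt_one (by norm_num) (by norm_num) hα0
  have hx0 : 0 < (1 / 2 : ℝ) ^ α := by positivity
  have hx2 : 0 < 1 - (1 / 2 : ℝ) ^ α := by linarith
  refine ⟨C * (1 / 2) ^ α * (1 - (1 / 2 : ℝ) ^ α)⁻¹, by positivity, fun δ hδ => ?_⟩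
  let S : ℕ → Set (Pt d) := fun n =>
    pCyl d (2 * (δ * (1 / 2) ^ (n + 1))) 0 \ pCyl d (δ * (1 / 2) ^ (n + 1)) 0
  have hcov : ∀ w ∈ pCyl d δ 0, w ∉ ⋃ n, S n → pKer d α w.1 ‖w.2‖ = 0 := by
    intro w hw hn
    unfold pKer
    rw [if_neg]
    intro hs
    have hall : ∀ n : ℕ, w ∈ pCyl d (δ * (1 / 2) ^ n) 0 := by
      intro n
      induction n with
      | zero => simpa using hw
      | succ n ih =>
        by_contra hc
        apply hn
        rw [mem_iUnion]
        refine ⟨n, ?_, hc⟩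
        have : 2 * (δ * (1 / 2 : ℝ) ^ (n + 1)) = δ * (1 / 2) ^ n := by rw [pow_succ]; ring
        rw [this]
        exact ih
    obtain ⟨n, hn⟩ := exists_pow_lt_of_lt_one (show 0 < w.1 / δ ^ 2 by positivity)
      (show (1 / 4 : ℝ) < 1 by norm_num)
    have h1 := (hall n).2.2
    rw [lt_div_iff₀ (by positivity)] at hn
    have : (δ * (1 / 2 : ℝ) ^ n) ^ 2 = (1 / 4) ^ n * δ ^ 2 := by
      rw [mul_pow, ← pow_mul, mul_comm n 2, pow_mul]; norm_num; ring
    simp only [Prod.fst_zero, zero_add] at h1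
    linarith
  have hk := meas_ker d α
  have hSm : ∀ n, MeasurableSet (S n) := fun n => (meas_pCyl _ _ _).diff (meas_pCyl _ _ _)
  calc ∫⁻ w in pCyl d δ 0, pKer d α w.1 ‖w.2‖
      ≤ ∫⁻ w in ⋃ n, S n, pKer d α w.1 ‖w.2‖ := by
        rw [← lintegral_indicator (meas_pCyl _ _ _), ← lintegral_indicator (MeasurableSet.iUnion hSm)]
        apply lintegral_mono
        intro w
        by_cases hw : w ∈ pCyl d δ 0
        · by_cases hw' : w ∈ ⋃ n, S n
          · simp only [indicator_of_mem hw, indicator_of_mem hw']; exact le_rfl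
          · simp only [indicator_of_mem hw]; rw [hcov w hw hw']; exact zero_le
        · simp only [indicator_of_notMem hw]; exact zero_le
    _ ≤ ∑' n, ∫⁻ w in S n, pKer d α w.1 ‖w.2‖ := lintegral_iUnion_le _ _
    _ ≤ ∑' n : ℕ, ENNReal.ofReal (C * (1 / 2) ^ α * δ ^ α * ((1 / 2 : ℝ) ^ α) ^ n) := by
        apply ENNReal.tsum_le_tsum
        intro n
        have := hsh (fun _ => 1) 1 0 measurable_const one_pos (fun ρ hρ => by simp)
          (δ * (1 / 2) ^ (n + 1)) (by positivity)
        simp only [mul_one] at this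
        refine this.trans (le_of_eq ?_)
        congr 1
        rw [sub_zero, Real.mul_rpow hδ.le (by positivity), ← Real.rpow_natCast, ← Real.rpow_mul (by norm_num),
          mul_comm ((n + 1 : ℕ) : ℝ), Real.rpow_mul (by norm_num), Real.rpow_natCast, pow_succ]
        ring
    _ = _ := by
        rw [geom_E _ _ (by positivity) hx0.le hx1]
        congr 1; ring

theorem outer_bd (d : ℕ) (α β : ℝ) (hαβ : α < β) (hα : α < (d : ℝ) + 2) :
    ∃ C : ℝ, 0 < C ∧ ∀ (f : Pt d → ℝ≥0∞) (A : ℝ) (z : Pt d), Measurable f → 0 < A →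
      (∀ ρ : ℝ, 0 < ρ → ∫⁻ w in pCyl d ρ z, f w
        ≤ ENNReal.ofReal (A * ρ ^ (-β)) * volume (pCyl d ρ z)) →
      ∀ δ : ℝ, 0 < δ → ∫⁻ w in (pCyl d δ 0)ᶜ, pKer d α w.1 ‖w.2‖ * f (z + w)
        ≤ ENNReal.ofReal (C * A * δ ^ (α - β)) := by
  obtain ⟨C, hC, hsh⟩ := shell d α hα β
  have hx1 : (2 : ℝ) ^ (α - β) < 1 := Real.rpow_lt_one_of_one_lt_of_neg (by norm_num) (by linarith)
  have hx0 : 0 < (2 : ℝ) ^ (α - β) := by positivity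
  have hx2 : 0 < 1 - (2 : ℝ) ^ (α - β) := by linarith
  refine ⟨C * (1 - (2 : ℝ) ^ (α - β))⁻¹, by positivity, fun f A z hf hA hfA δ hδ => ?_⟩
  let S : ℕ → Set (Pt d) := fun n =>
    pCyl d (2 * (δ * 2 ^ n)) 0 \ pCyl d (δ * 2 ^ n) 0
  have hcov : ∀ w ∈ (pCyl d δ 0)ᶜ, w ∉ ⋃ n, S n → pKer d α w.1 ‖w.2‖ = 0 := by
    intro w hw hn
    unfold pKer
    rw [if_neg]
    intro hs
    have hall : ∀ n : ℕ, w ∉ pCyl d (δ * 2 ^ n) 0 := by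
      intro n
      induction n with
      | zero => simpa using hw
      | succ n ih =>
        intro hc
        apply hn
        rw [mem_iUnion]
        refine ⟨n, ?_, ih⟩
        have : 2 * (δ * (2 : ℝ) ^ n) = δ * 2 ^ (n + 1) := by rw [pow_succ]; ring
        rw [this]
        exact hc
    obtain ⟨n, hn⟩ := pow_unbounded_of_one_lt ((‖w.2‖ + w.1 + 1) / δ) (show (1 : ℝ) < 2 by norm_num)
    rw [div_lt_iff₀ hδ] at hn
    apply hall n
    have hw2 := norm_nonneg w.2
    refine ⟨?_, ?_, ?_⟩
    · simp only [Prod.snd_zero, dist_zero_left]; linarith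
    · simpa using hs.le
    · simp only [Prod.fst_zero, zero_add]; nlinarith
  have hSm : ∀ n, MeasurableSet (S n) := fun n => (meas_pCyl _ _ _).diff (meas_pCyl _ _ _)
  calc ∫⁻ w in (pCyl d δ 0)ᶜ, pKer d α w.1 ‖w.2‖ * f (z + w)
      ≤ ∫⁻ w in ⋃ n, S n, pKer d α w.1 ‖w.2‖ * f (z + w) := by
        rw [← lintegral_indicator (meas_pCyl _ _ _).compl,
          ← lintegral_indicator (MeasurableSet.iUnion hSm)]
        apply lintegral_mono
        intro w
        by_cases hw : w ∈ (pCyl d δ 0)ᶜ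
        · by_cases hw' : w ∈ ⋃ n, S n
          · simp only [indicator_of_mem hw, indicator_of_mem hw']; exact le_rfl
          · simp only [indicator_of_mem hw]; rw [hcov w hw hw', zero_mul]; exact zero_le
        · simp only [indicator_of_notMem hw]; exact zero_le
    _ ≤ ∑' n, ∫⁻ w in S n, pKer d α w.1 ‖w.2‖ * f (z + w) := lintegral_iUnion_le _ _
    _ ≤ ∑' n : ℕ, ENNReal.ofReal (C * A * δ ^ (α - β) * ((2 : ℝ) ^ (α - β)) ^ n) := by
        apply ENNReal.tsum_le_tsum
        intro n
        refine (hsh f A z hf hA hfA (δ * 2 ^ n) (by positivity)).trans (le_of_eq ?_)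
        congr 1
        rw [Real.mul_rpow hδ.le (by positivity), ← Real.rpow_natCast, ← Real.rpow_mul (by norm_num),
          mul_comm (n : ℝ), Real.rpow_mul (by norm_num), Real.rpow_natCast]
        ring
    _ = _ := by
        rw [geom_E _ _ (by positivity) hx0.le hx1]
        congr 1; ring

theorem morrey_q (d : ℕ) (q β A : ℝ) (hq : 1 < q) (hA : 0 < A) (f : Pt d → ℝ≥0∞)
    (h : MorreyNorm d q β univ f ≤ ENNReal.ofReal A) (ρ : ℝ) (hρ : 0 < ρ) (z : Pt d) :
    ∫⁻ w in pCyl d ρ z, f w ^ q ≤ ENNReal.ofReal ((A * ρ ^ (-β)) ^ q) * volume (pCyl d ρ z) := by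
  have h1 : ENNReal.ofReal (ρ ^ β) * (pAvg d ρ z fun w => f w ^ q) ^ (1 / q) ≤ ENNReal.ofReal A := by
    refine le_trans ?_ h
    unfold MorreyNorm
    have := le_iSup₂_of_le (f := fun (ρ : ℝ) (_ : 0 < ρ) => ⨆ (z : Pt d) (_ : z ∈ univ),
      ENNReal.ofReal (ρ ^ β) * (pAvg d ρ z fun w => univ.indicator f w ^ q) ^ (1 / q)) ρ hρ
      (le_iSup₂_of_le (f := fun (z : Pt d) (_ : z ∈ univ) =>
      ENNReal.ofReal (ρ ^ β) * (pAvg d ρ z fun w => univ.indicator f w ^ q) ^ (1 / q)) z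
        (mem_univ z) le_rfl)
    simpa only [indicator_univ] using this
  have hv : volume (pCyl d ρ z) ≠ 0 ∧ volume (pCyl d ρ z) ≠ ⊤ := by
    rw [vol_pCyl d ρ hρ z]
    constructor
    · apply mul_ne_zero
      · rw [Ne, ENNReal.ofReal_eq_zero, not_le]; positivity
      · exact (Metric.measure_ball_pos _ _ one_pos).ne'
    · exact ENNReal.mul_ne_top ENNReal.ofReal_ne_top measure_ball_lt_top.ne
  have h2 : (pAvg d ρ z fun w => f w ^ q) ^ (1 / q) ≤ ENNReal.ofReal (A * ρ ^ (-β)) := by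
    calc (pAvg d ρ z fun w => f w ^ q) ^ (1 / q)
        = ENNReal.ofReal (ρ ^ (-β)) * (ENNReal.ofReal (ρ ^ β) *
            (pAvg d ρ z fun w => f w ^ q) ^ (1 / q)) := by
          rw [← mul_assoc, ← ENNReal.ofReal_mul (by positivity), ← Real.rpow_add hρ]
          simp
      _ ≤ ENNReal.ofReal (ρ ^ (-β)) * ENNReal.ofReal A := by gcongr
      _ = _ := by rw [← ENNReal.ofReal_mul (by positivity), mul_comm]
  have h3 : (pAvg d ρ z fun w => f w ^ q) ≤ ENNReal.ofReal ((A * ρ ^ (-β)) ^ q) := by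
    rw [← ENNReal.ofReal_rpow_of_pos (by positivity)]
    rwa [one_div, ENNReal.rpow_inv_le_iff (by linarith)] at h2
  unfold pAvg at h3
  rw [mul_comm, ← div_eq_mul_inv, ENNReal.div_le_iff hv.1 hv.2] at h3
  exact h3

theorem morrey_1 (d : ℕ) (q β A : ℝ) (hq : 1 < q) (hA : 0 < A) (f : Pt d → ℝ≥0∞)
    (hf : Measurable f)
    (h : MorreyNorm d q β univ f ≤ ENNReal.ofReal A) (ρ : ℝ) (hρ : 0 < ρ) (z : Pt d) :
    ∫⁻ w in pCyl d ρ z, f w ≤ ENNReal.ofReal (A * ρ ^ (-β)) * volume (pCyl d ρ z) := by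
  have h1 := morrey_q d q β A hq hA f h ρ hρ z
  have hpq : q.HolderConjugate (q / (q - 1)) := Real.HolderConjugate.conjExponent hq
  have h2 := ENNReal.lintegral_mul_le_Lp_mul_Lq (volume.restrict (pCyl d ρ z)) hpq
    hf.aemeasurable (g := fun _ => 1) aemeasurable_const
  simp only [Pi.mul_apply, mul_one, ENNReal.one_rpow, lintegral_const, one_mul,
    Measure.restrict_apply MeasurableSet.univ, univ_inter] at h2
  refine h2.trans ?_
  have hq0 : 0 < q := by linarith
  calc _ ≤ (ENNReal.ofReal ((A * ρ ^ (-β)) ^ q) * volume (pCyl d ρ z)) ^ (1 / q) *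
        volume (pCyl d ρ z) ^ (1 / (q / (q - 1))) := by gcongr
    _ = _ := by
      rw [ENNReal.mul_rpow_of_nonneg _ _ (by positivity), mul_assoc,
        ← ENNReal.rpow_add_of_nonneg _ _ (by positivity)
          (by have : 0 < q - 1 := by linarith
              positivity)]
      have e : 1 / q + 1 / (q / (q - 1)) = 1 := by
        have : q - 1 ≠ 0 := by linarith
        field_simp
        ring
      rw [e, ENNReal.rpow_one, ENNReal.ofReal_rpow_of_pos (by positivity), ← Real.rpow_mul (by positivity),
        mul_one_div_cancel hq0.ne', Real.rpow_one]

theorem geo_ind (b p s : ℝ) (hb : 1 < b) (hp : 0 < p) (hs : 0 < s) (u : ℝ≥0∞) :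
    ∑' n : ℕ, (if ENNReal.ofReal (s * b ^ n) < u then ENNReal.ofReal ((b ^ p) ^ n) else 0)
      ≤ ENNReal.ofReal ((1 - (b ^ p)⁻¹)⁻¹ * s ^ (-p)) * u ^ p := by
  have hb0 : 0 < b := by linarith
  have hc1 : 1 < b ^ p := Real.one_lt_rpow hb hp
  have hK : 0 < 1 - (b ^ p)⁻¹ := by
    have := inv_lt_one_of_one_lt₀ hc1
    linarith
  apply ENNReal.tsum_le_of_sum_range_le
  intro M
  induction M with
  | zero => simp
  | succ M ih =>
    by_cases h : ENNReal.ofReal (s * b ^ M) < u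
    · calc ∑ n ∈ Finset.range (M + 1),
            (if ENNReal.ofReal (s * b ^ n) < u then ENNReal.ofReal ((b ^ p) ^ n) else 0)
          ≤ ∑ n ∈ Finset.range (M + 1), ENNReal.ofReal ((b ^ p) ^ n) := by
            apply Finset.sum_le_sum
            intro n _
            split_ifs
            · exact le_rfl
            · exact zero_le
        _ = ENNReal.ofReal (∑ n ∈ Finset.range (M + 1), (b ^ p) ^ n) := by
            rw [ENNReal.ofReal_sum_of_nonneg]
            intro n _
            positivity
        _ ≤ ENNReal.ofReal ((1 - (b ^ p)⁻¹)⁻¹ * (b ^ p) ^ M) := by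
            apply ENNReal.ofReal_le_ofReal
            rw [geom_sum_eq hc1.ne']
            have e : (1 - (b ^ p)⁻¹)⁻¹ = b ^ p / (b ^ p - 1) := by
              have : b ^ p - 1 ≠ 0 := by linarith
              have h3 : b ^ p ≠ 0 := by linarith
              rw [inv_eq_one_div, div_eq_div_iff hK.ne' this]
              field_simp
            rw [e, div_mul_eq_mul_div, pow_succ]
            have : 0 < b ^ p - 1 := by linarith
            gcongr
            linarith
        _ = ENNReal.ofReal ((1 - (b ^ p)⁻¹)⁻¹ * s ^ (-p)) * ENNReal.ofReal (s * b ^ M) ^ p := by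
            rw [ENNReal.ofReal_rpow_of_pos (by positivity), ← ENNReal.ofReal_mul (by positivity)]
            congr 1
            rw [mul_assoc]
            congr 1
            rw [Real.mul_rpow hs.le (by positivity), ← mul_assoc, ← Real.rpow_add hs]
            simp only [neg_add_cancel, Real.rpow_zero, one_mul]
            rw [← Real.rpow_natCast, ← Real.rpow_natCast, ← Real.rpow_mul hb0.le,
              ← Real.rpow_mul hb0.le, mul_comm]
        _ ≤ _ := by gcongr
    · rw [Finset.sum_range_succ, if_neg h, add_zero]
      exact ih

theorem layer (l x r : ℝ) (hl : 0 < l) (hx : 1 < x) (hr : 0 < r) (G : ℝ≥0∞) (T : ℕ → ℝ≥0∞)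
    (h : ∀ n, ENNReal.ofReal (l * x ^ n) < G → ENNReal.ofReal (l * x ^ n / 4) ≤ T n) :
    G ^ r ≤ ENNReal.ofReal (l ^ r) +
      ∑' n, ENNReal.ofReal ((l * x ^ (n + 1)) ^ r * (4 / (l * x ^ n))) * T n := by
  have hx0 : 0 < x := by linarith
  have hT : ∀ n, ENNReal.ofReal (l * x ^ n) < G → ENNReal.ofReal ((l * x ^ (n + 1)) ^ r) ≤
      ENNReal.ofReal ((l * x ^ (n + 1)) ^ r * (4 / (l * x ^ n))) * T n := by
    intro n hn
    calc ENNReal.ofReal ((l * x ^ (n + 1)) ^ r)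
        = ENNReal.ofReal ((l * x ^ (n + 1)) ^ r * (4 / (l * x ^ n))) *
            ENNReal.ofReal (l * x ^ n / 4) := by
          rw [← ENNReal.ofReal_mul (by positivity)]
          congr 1
          field_simp
      _ ≤ _ := by gcongr; exact h n hn
  by_cases hG : ∃ n, G ≤ ENNReal.ofReal (l * x ^ n)
  · classical
    have hs := Nat.find_spec hG
    rcases hm : Nat.find hG with _ | m
    · rw [hm] at hs
      refine le_trans ?_ le_self_add
      rw [← ENNReal.ofReal_rpow_of_pos hl]
      gcongr
      simpa using hs
    · have hmin := Nat.find_min hG (m := m) (by omega)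
      rw [hm] at hs
      refine le_trans ?_ le_add_self
      refine le_trans ?_ (ENNReal.le_tsum m)
      refine le_trans ?_ (hT m (not_le.1 hmin))
      rw [← ENNReal.ofReal_rpow_of_pos (by positivity)]
      gcongr
  · push Not at hG
    have : ∑' n, ENNReal.ofReal ((l * x ^ (n + 1)) ^ r * (4 / (l * x ^ n))) * T n = ⊤ := by
      rw [eq_top_iff]
      calc (⊤ : ℝ≥0∞) = ∑' n : ℕ, ENNReal.ofReal (l ^ r) := by
            rw [ENNReal.tsum_const_eq_top_of_ne_zero]
            rw [Ne, ENNReal.ofReal_eq_zero, not_le]; positivity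
        _ ≤ _ := by
            apply ENNReal.tsum_le_tsum
            intro n
            refine le_trans (ENNReal.ofReal_le_ofReal ?_) (hT n (hG n))
            gcongr
            exact le_mul_of_one_le_right hl.le (one_le_pow₀ hx.le)
    rw [this]
    simp

theorem T_int (d : ℕ) (k h : Pt d → ℝ≥0∞) (hk : Measurable k) (hh : Measurable h)
    (C D : Set (Pt d)) :
    ∫⁻ z in C, ∫⁻ w in D, k w * h (z + w) ≤ (∫⁻ w in D, k w) * ∫⁻ w, h w := by
  have := vol_inv d
  have hm : Measurable (fun p : Pt d × Pt d => k p.2 * h (p.1 + p.2)) :=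
    (hk.comp measurable_snd).mul (hh.comp (measurable_fst.add measurable_snd))
  calc ∫⁻ z in C, ∫⁻ w in D, k w * h (z + w)
      ≤ ∫⁻ z, ∫⁻ w in D, k w * h (z + w) := setLIntegral_le_lintegral _ _
    _ = ∫⁻ w in D, ∫⁻ z, k w * h (z + w) := lintegral_lintegral_swap hm.aemeasurable
    _ = ∫⁻ w in D, k w * ∫⁻ z, h z := by
        congr 1
        ext w
        have hm2 : Measurable (fun z => h (z + w)) := hh.comp (measurable_id.add_const w)
        rw [lintegral_const_mul _ hm2,
          lintegral_add_right_eq_self h w]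
    _ = _ := lintegral_mul_const _ hk

theorem main_avg (d : ℕ) (q α β r : ℝ) (hq : 1 < q)
    (hα : 0 < α) (hαβ : α < β) (hα2 : α < (d : ℝ) + 2)
    (hr : r * (β - α) = q * β) (hr0 : 0 < r) :
    ∃ M C : ℝ, 0 < M ∧ 0 < C ∧ ∀ (f : Pt d → ℝ≥0∞) (A : ℝ), Measurable f → 0 < A →
      MorreyNorm d q β univ f ≤ ENNReal.ofReal A → ∀ (ρ : ℝ) (z : Pt d), 0 < ρ →
      ∫⁻ w in pCyl d ρ z, Palpha d α f w ^ r ≤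
        ENNReal.ofReal ((C * A * ρ ^ (α - β)) ^ r * M) * volume (pCyl d ρ z) := by
  obtain ⟨C1, hC1, hin⟩ := inner_bd d α hα hα2
  obtain ⟨C2, hC2, hout⟩ := outer_bd d α β hαβ hα2
  have hβ0 : 0 < β := by linarith
  set b : ℝ := 2 ^ β with hb
  have hb1 : 1 < b := Real.one_lt_rpow (by norm_num) hβ0
  have hb0 : 0 < b := by linarith
  have hbq1 : 1 < b ^ (q - 1) := Real.one_lt_rpow hb1 (by linarith)
  set K : ℝ := (1 - (b ^ (q - 1))⁻¹)⁻¹ with hKdef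
  have hK : 0 < K := by
    have := inv_lt_one_of_one_lt₀ hbq1
    rw [hKdef, inv_pos]
    linarith
  set x : ℝ := 2 ^ (β - α) with hx
  have hx1 : 1 < x := Real.one_lt_rpow (by norm_num) (by linarith)
  have hx0 : 0 < x := by linarith
  have hxr : x ^ r = b ^ q := by
    rw [hx, hb, ← Real.rpow_mul (by norm_num), ← Real.rpow_mul (by norm_num), mul_comm, hr, mul_comm]
  refine ⟨1 + b ^ q * K * (2 * C1 / C2 * 2 ^ (-β)) ^ q * 2 ^ ((d : ℝ) + 2), 2 * C2,
    by positivity, by positivity, fun f A hf hA hfA ρ z0 hρ => ?_⟩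
  set l : ℝ := 2 * C2 * A * ρ ^ (α - β) with hl
  have hl0 : 0 < l := by positivity
  set s : ℝ := C2 / (2 * C1) * A * ρ ^ (-β) with hs
  have hs0 : 0 < s := by positivity
  -- the radii
  let δ : ℕ → ℝ := fun n => ρ * (1 / 2) ^ n
  have hδ0 : ∀ n, 0 < δ n := fun n => by positivity
  have hδρ : ∀ n, δ n ≤ ρ := fun n =>
    mul_le_of_le_one_right hρ.le (pow_le_one₀ (by norm_num) (by norm_num))
  have hδp : ∀ (e : ℝ) (n : ℕ), (δ n) ^ (-e) = ρ ^ (-e) * ((2 : ℝ) ^ e) ^ n := by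
    intro e n
    show (ρ * (1 / 2) ^ n) ^ (-e) = _
    rw [Real.mul_rpow hρ.le (by positivity), ← Real.rpow_natCast, ← Real.rpow_mul (by norm_num),
      ← Real.rpow_natCast, ← Real.rpow_mul (by norm_num), one_div, Real.inv_rpow (by norm_num),
      ← Real.rpow_neg (by norm_num)]
    congr 2
    ring
  have hδα : ∀ n, C2 * A * δ n ^ (α - β) = l * x ^ n / 2 := by
    intro n
    have := hδp (β - α) n
    rw [neg_sub] at this
    rw [this, hl, hx]
    ring
  have hδs : ∀ n, C1 * δ n ^ α * (s * b ^ n) = l * x ^ n / 4 := by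
    intro n
    have h1 : s * b ^ n = C2 / (2 * C1) * A * δ n ^ (-β) := by
      rw [hδp, hs, hb]; ring
    have h2 : δ n ^ α * δ n ^ (-β) = δ n ^ (α - β) := by
      rw [← Real.rpow_add (hδ0 n)]; congr 1
    have h3 : l * x ^ n / 4 = (C2 * A * δ n ^ (α - β)) / 2 := by rw [hδα]; ring
    rw [h1, h3, ← h2]
    field_simp
  let S : ℕ → Set (Pt d) := fun n => pCyl d (2 * ρ) z0 ∩ {w | ENNReal.ofReal (s * b ^ n) < f w}
  have hSm : ∀ n, MeasurableSet (S n) := fun n =>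
    (meas_pCyl _ _ _).inter (measurableSet_lt measurable_const hf)
  let F : ℕ → Pt d → ℝ≥0∞ := fun n => (S n).indicator f
  have hFm : ∀ n, Measurable (F n) := fun n => hf.indicator (hSm n)
  let T : ℕ → Pt d → ℝ≥0∞ := fun n z =>
    ∫⁻ w in pCyl d (δ n) 0, pKer d α w.1 ‖w.2‖ * F n (z + w)
  have hker := meas_ker d α
  have hTm : ∀ n, Measurable (T n) := by
    intro n
    have hm : Measurable (fun p : Pt d × Pt d => pKer d α p.2.1 ‖p.2.2‖ * F n (p.1 + p.2)) :=
      (hker.comp measurable_snd).mul ((hFm n).comp (measurable_fst.add measurable_snd))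
    exact hm.lintegral_prod_right'
  have hkey : ∀ z ∈ pCyl d ρ z0, ∀ n, ENNReal.ofReal (l * x ^ n) < Palpha d α f z →
      ENNReal.ofReal (l * x ^ n / 4) ≤ T n z := by
    intro z hz n hn
    have hD := meas_pCyl d (δ n) 0
    have hP : Palpha d α f z = (∫⁻ w in pCyl d (δ n) 0, pKer d α w.1 ‖w.2‖ * f (z + w)) +
        ∫⁻ w in (pCyl d (δ n) 0)ᶜ, pKer d α w.1 ‖w.2‖ * f (z + w) := by
      rw [lintegral_add_compl _ hD]
      rfl
    have ho := hout f A z hf hA (fun ρ hρ => morrey_1 d q β A hq hA f hf hfA ρ hρ z) (δ n) (hδ0 n)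
    rw [hδα] at ho
    have hi : ∫⁻ w in pCyl d (δ n) 0, pKer d α w.1 ‖w.2‖ * f (z + w) ≤
        ENNReal.ofReal (l * x ^ n / 4) + T n z := by
      calc ∫⁻ w in pCyl d (δ n) 0, pKer d α w.1 ‖w.2‖ * f (z + w)
          ≤ ∫⁻ w in pCyl d (δ n) 0, (pKer d α w.1 ‖w.2‖ * ENNReal.ofReal (s * b ^ n) +
              pKer d α w.1 ‖w.2‖ * F n (z + w)) := by
            apply setLIntegral_mono' hD
            intro w hw
            rw [← mul_add]
            gcongr
            by_cases hfw : ENNReal.ofReal (s * b ^ n) < f (z + w)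
            · have hmem : z + w ∈ S n := by
                refine ⟨?_, hfw⟩
                obtain ⟨z1, z2, z3⟩ := hz
                obtain ⟨w1, w2, w3⟩ := hw
                simp only [Prod.fst_zero, Prod.snd_zero, dist_zero_left, zero_add] at w1 w2 w3
                have hd1 := hδρ n
                have hd0 := hδ0 n
                refine ⟨?_, ?_, ?_⟩
                · calc dist z0.2 (z + w).2 ≤ dist z0.2 z.2 + dist z.2 (z + w).2 := dist_triangle _ _ _
                    _ = dist z0.2 z.2 + ‖w.2‖ := by simp [dist_eq_norm]
                    _ < 2 * ρ := by linarith
                · simp only [Prod.fst_add]; linarith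
                · simp only [Prod.fst_add]; nlinarith
              show _ ≤ _ + (S n).indicator f (z + w)
              rw [indicator_of_mem hmem]
              exact le_add_self
            · exact le_trans (not_lt.1 hfw) le_self_add
        _ = (∫⁻ w in pCyl d (δ n) 0, pKer d α w.1 ‖w.2‖) * ENNReal.ofReal (s * b ^ n) + T n z := by
            rw [lintegral_add_left (hker.mul_const _), lintegral_mul_const _ hker]
        _ ≤ ENNReal.ofReal (C1 * δ n ^ α) * ENNReal.ofReal (s * b ^ n) + T n z := by
            gcongr
            exact hin _ (hδ0 n)
        _ = _ := by
            have := hδ0 n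
            rw [← ENNReal.ofReal_mul (by positivity), hδs]
    by_contra hc
    push Not at hc
    have hlx : 0 < l * x ^ n := by positivity
    have : Palpha d α f z ≤ ENNReal.ofReal (l * x ^ n) := by
      rw [hP]
      calc _ ≤ ENNReal.ofReal (l * x ^ n / 4) + ENNReal.ofReal (l * x ^ n / 4) +
            ENNReal.ofReal (l * x ^ n / 2) := by
            gcongr
            exact hi.trans (by gcongr)
        _ = _ := by
            rw [← ENNReal.ofReal_add (by positivity) (by positivity),
              ← ENNReal.ofReal_add (by positivity) (by positivity)]
            congr 1; ring
    exact absurd hn (not_lt.2 this)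
  let c : ℕ → ℝ := fun n => (l * x ^ (n + 1)) ^ r * (4 / (l * x ^ n))
  have hc0 : ∀ n, 0 < c n := fun n => by positivity
  have hcn : ∀ n, c n * (C1 * δ n ^ α) = l ^ r * b ^ q * s⁻¹ * (b ^ (q - 1)) ^ n := by
    intro n
    have h1 := hδs n
    have h2 : (l * x ^ (n + 1)) ^ r = l ^ r * b ^ q * (b ^ q) ^ n := by
      rw [Real.mul_rpow hl0.le (by positivity), ← hxr, pow_succ, Real.mul_rpow (by positivity) hx0.le,
        ← Real.rpow_natCast x n, ← Real.rpow_mul hx0.le, ← Real.rpow_natCast (x ^ r) n,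
        ← Real.rpow_mul hx0.le, mul_comm r]
      ring
    have h3 : b ^ (q - 1) = b ^ q / b := Real.rpow_sub_one hb0.ne' q
    show (l * x ^ (n + 1)) ^ r * (4 / (l * x ^ n)) * (C1 * δ n ^ α) = _
    rw [h2, h3, div_pow]
    have h4 : 4 / (l * x ^ n) * (C1 * δ n ^ α) = (s * b ^ n)⁻¹ := by
      have h5 : C1 * δ n ^ α = l * x ^ n / 4 / (s * b ^ n) := by
        rw [_root_.eq_div_iff (by positivity)]; exact h1
      rw [h5]
      field_simp
    rw [mul_assoc, h4]
    field_simp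
  calc ∫⁻ w in pCyl d ρ z0, Palpha d α f w ^ r
      ≤ ∫⁻ w in pCyl d ρ z0, (ENNReal.ofReal (l ^ r) + ∑' n, ENNReal.ofReal (c n) * T n w) := by
        apply setLIntegral_mono' (meas_pCyl _ _ _)
        intro z hz
        exact layer l x r hl0 hx1 hr0 _ (fun n => T n z) (hkey z hz)
    _ = ENNReal.ofReal (l ^ r) * volume (pCyl d ρ z0) +
          ∑' n, ENNReal.ofReal (c n) * ∫⁻ w in pCyl d ρ z0, T n w := by
        rw [lintegral_add_left measurable_const, setLIntegral_const,
          lintegral_tsum (fun n => ((hTm n).const_mul _).aemeasurable)]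
        congr 2
        ext n
        rw [lintegral_const_mul _ (hTm n)]
    _ ≤ ENNReal.ofReal (l ^ r) * volume (pCyl d ρ z0) +
          ∑' n, ENNReal.ofReal (l ^ r * b ^ q * s⁻¹ * (b ^ (q - 1)) ^ n) * ∫⁻ w, F n w := by
        refine add_le_add le_rfl (ENNReal.tsum_le_tsum fun n => ?_)
        calc ENNReal.ofReal (c n) * ∫⁻ w in pCyl d ρ z0, T n w
            ≤ ENNReal.ofReal (c n) * (ENNReal.ofReal (C1 * δ n ^ α) * ∫⁻ w, F n w) := by
              gcongr
              refine (T_int d _ (F n) hker (hFm n) _ _).trans ?_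
              gcongr
              exact hin _ (hδ0 n)
          _ = _ := by
              rw [← mul_assoc, ← ENNReal.ofReal_mul (hc0 n).le, hcn]
    _ = ENNReal.ofReal (l ^ r) * volume (pCyl d ρ z0) +
          ∫⁻ w, ∑' n, ENNReal.ofReal (l ^ r * b ^ q * s⁻¹ * (b ^ (q - 1)) ^ n) * F n w := by
        rw [lintegral_tsum (fun n => ((hFm n).const_mul _).aemeasurable)]
        congr 2
        ext n
        rw [lintegral_const_mul _ (hFm n)]
    _ ≤ ENNReal.ofReal (l ^ r) * volume (pCyl d ρ z0) +
          ∫⁻ w in pCyl d (2 * ρ) z0, ENNReal.ofReal (l ^ r * b ^ q * K * s ^ (-q)) * f w ^ q := by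
        refine add_le_add le_rfl ?_
        rw [← lintegral_indicator (meas_pCyl _ _ _)]
        apply lintegral_mono
        intro w
        by_cases hw : w ∈ pCyl d (2 * ρ) z0
        · simp only [indicator_of_mem hw]
          have hF : ∀ n, ENNReal.ofReal (l ^ r * b ^ q * s⁻¹ * (b ^ (q - 1)) ^ n) * F n w =
              ENNReal.ofReal (l ^ r * b ^ q * s⁻¹) * f w *
              (if ENNReal.ofReal (s * b ^ n) < f w then ENNReal.ofReal ((b ^ (q - 1)) ^ n) else 0) := by
            intro n
            show _ * (S n).indicator f w = _
            split_ifs with hh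
            · rw [indicator_of_mem (show w ∈ S n from ⟨hw, hh⟩), ENNReal.ofReal_mul (by positivity)]
              ring
            · rw [indicator_of_notMem (fun h => hh h.2)]
              simp
          simp_rw [hF]
          rw [ENNReal.tsum_mul_left]
          calc _ ≤ ENNReal.ofReal (l ^ r * b ^ q * s⁻¹) * f w *
                (ENNReal.ofReal (K * s ^ (-(q - 1))) * f w ^ (q - 1)) := by
                gcongr
                exact geo_ind b (q - 1) s hb1 (by linarith) hs0 (f w)
            _ = ENNReal.ofReal (l ^ r * b ^ q * s⁻¹) * ENNReal.ofReal (K * s ^ (-(q - 1))) *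
                (f w * f w ^ (q - 1)) := by ring
            _ = _ := by
                rw [← ENNReal.ofReal_mul (by positivity)]
                congr 1
                · congr 1
                  have : s ^ (-q) = s⁻¹ * s ^ (-(q - 1)) := by
                    rw [← Real.rpow_neg_one s, ← Real.rpow_add hs0]
                    congr 1; ring
                  rw [this]; ring
                · nth_rewrite 1 [← ENNReal.rpow_one (f w)]
                  rw [← ENNReal.rpow_add_of_nonneg _ _ (by norm_num) (by linarith)]
                  congr 1; ring
        · simp only [indicator_of_notMem hw]
          have hF : ∀ n, F n w = 0 := fun n => indicator_of_notMem (fun h => hw h.1) _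
          simp [hF]
    _ ≤ ENNReal.ofReal (l ^ r) * volume (pCyl d ρ z0) +
          ENNReal.ofReal (l ^ r * b ^ q * K * s ^ (-q)) *
            (ENNReal.ofReal ((A * (2 * ρ) ^ (-β)) ^ q) * volume (pCyl d (2 * ρ) z0)) := by
        rw [lintegral_const_mul _ (hf.pow_const q)]
        gcongr
        exact morrey_q d q β A hq hA f hfA (2 * ρ) (by positivity) z0
    _ = _ := by
        have h0 : (2 * ρ) ^ ((d : ℝ) + 2) = 2 ^ ((d : ℝ) + 2) * ρ ^ ((d : ℝ) + 2) :=
          Real.mul_rpow (by norm_num) hρ.le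
        rw [vol_pCyl d _ (by positivity : 0 < 2 * ρ), vol_pCyl d _ hρ, h0]
        simp only [← mul_assoc]
        rw [← ENNReal.ofReal_mul (by positivity), ← ENNReal.ofReal_mul (by positivity),
          ← ENNReal.ofReal_mul (by positivity), ← ENNReal.ofReal_mul (by positivity), ← add_mul,
          ← ENNReal.ofReal_add (by positivity) (by positivity)]
        congr 2
        have h1 : s ^ (-q) * (A * (2 * ρ) ^ (-β)) ^ q = (2 * C1 / C2 * 2 ^ (-β)) ^ q := by
          rw [Real.rpow_neg hs0.le, ← Real.inv_rpow hs0.le, ← Real.mul_rpow (by positivity) (by positivity)]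
          congr 1
          rw [hs, Real.mul_rpow (by norm_num) hρ.le]
          field_simp
        rw [← h1]
        ring

/-- Theorem 3.1: for `α ∈ (0,β)`, `β ∈ (0,(d+2)/q]`, `q ∈ (1,∞)` and
`r(β−α) = qβ` one has `‖P_α f‖_{E_{r,β−α}} ≤ N ‖f‖_{E_{q,β}}`. -/
theorem stmt6 (d : ℕ) (hd : 1 ≤ d) (q α β r : ℝ) (hq : 1 < q)
    (hα : 0 < α) (hαβ : α < β) (hβ : β ≤ ((d : ℝ) + 2) / q)
    (hr : r * (β - α) = q * β) :
    ∃ N : ℝ, 0 < N ∧ ∀ f : Pt d → ℝ≥0∞, Measurable f →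
      MorreyNorm d r (β - α) univ (Palpha d α f) ≤
        ENNReal.ofReal N * MorreyNorm d q β univ f := by
  have hq0 : 0 < q := by linarith
  have hβ0 : 0 < β := by linarith
  have ha : 0 < β - α := by linarith
  have hr0 : 0 < r := by
    have : 0 < r * (β - α) := by rw [hr]; positivity
    exact pos_of_mul_pos_left this ha.le
  have hα2 : α < (d : ℝ) + 2 := by
    have h1 : ((d : ℝ) + 2) / q ≤ (d : ℝ) + 2 := div_le_self (by positivity) hq.le
    linarith
  obtain ⟨M, C, hM, hC, hmain⟩ := main_avg d q α β r hq hα hαβ hα2 hr hr0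
  refine ⟨C * M ^ (1 / r), by positivity, fun f hf => ?_⟩
  have hN : 0 < C * M ^ (1 / r) := by positivity
  -- it suffices to bound by every real number above the norm of `f`
  have hstep : ∀ A : ℝ, 0 < A → MorreyNorm d q β univ f ≤ ENNReal.ofReal A →
      MorreyNorm d r (β - α) univ (Palpha d α f) ≤
        ENNReal.ofReal (C * M ^ (1 / r)) * ENNReal.ofReal A := by
    intro A hA hfA
    unfold MorreyNorm
    refine iSup₂_le fun ρ hρ => iSup₂_le fun z _ => ?_
    simp only [indicator_univ]
    have h1 := hmain f A hf hA hfA ρ z hρ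
    have h2 : (pAvg d ρ z fun w => Palpha d α f w ^ r) ≤
        ENNReal.ofReal ((C * A * ρ ^ (α - β)) ^ r * M) := by
      unfold pAvg
      rw [mul_comm, ← div_eq_mul_inv]
      exact ENNReal.div_le_of_le_mul h1
    calc _ ≤ ENNReal.ofReal (ρ ^ (β - α)) *
          (ENNReal.ofReal ((C * A * ρ ^ (α - β)) ^ r * M)) ^ (1 / r) := by gcongr
      _ = _ := by
        rw [ENNReal.ofReal_rpow_of_pos (by positivity), ← ENNReal.ofReal_mul (by positivity),
          ← ENNReal.ofReal_mul (by positivity), Real.mul_rpow (by positivity) hM.le,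
          ← Real.rpow_mul (by positivity), mul_one_div_cancel hr0.ne', Real.rpow_one]
        congr 1
        have : ρ ^ (β - α) * ρ ^ (α - β) = 1 := by
          rw [← Real.rpow_add hρ]; simp
        linear_combination C * A * M ^ (1 / r) * this
  by_cases htop : MorreyNorm d q β univ f = ⊤
  · rw [htop, ENNReal.mul_top (by rw [Ne, ENNReal.ofReal_eq_zero, not_le]; exact hN)]
    exact le_top
  · refine ENNReal.le_of_forall_pos_le_add fun ε hε _ => ?_
    have hεN : 0 < (ε : ℝ) / (C * M ^ (1 / r)) := by positivity
    have h1 := hstep ((MorreyNorm d q β univ f).toReal + (ε : ℝ) / (C * M ^ (1 / r)))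
      (by positivity) (by
        rw [ENNReal.ofReal_add ENNReal.toReal_nonneg hεN.le, ENNReal.ofReal_toReal htop]
        exact le_self_add)
    refine h1.trans (le_of_eq ?_)
    rw [ENNReal.ofReal_add ENNReal.toReal_nonneg hεN.le, ENNReal.ofReal_toReal htop, mul_add,
      ← ENNReal.ofReal_mul hN.le, mul_div_cancel₀ _ hN.ne', ENNReal.ofReal_coe_nnreal]
end
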